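/- arXiv:1303.4225 — 2 statements merged into one kernel-verified Lean document; each statement's English description precedes it below -/
import Mathlib

section
/- Suppose (u₀, u₁) ≢ 0. Then for every s ∈ [−M, M] and every τ with 0 ≤ τ < τ₀ the following holds: if F₀'(s) ≠ 0, then exp((1/2)F₀'(s)τ)·(1 − F₀''(s)/F₀'(s)) + F₀''(s)/F₀'(s) > 0; and if F₀'(s) = 0, then 1 − (τ/2)F₀''(s) > 0. (Hence the Jacobian ∂_s q(τ,s) of the characteristic map is strictly positive for all 0 ≤ τ < τ₀.) -/
open Set Filter MeasureTheory

noncomputable section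

/-- `F₀(s) = (1/2)(s u₀(s) + ∫_s^∞ ρ u₁(ρ) dρ)` -/
def F0 (u₀ u₁ : ℝ → ℝ) (s : ℝ) : ℝ := (1 / 2) * (s * u₀ s + ∫ ρ in Set.Ioi s, ρ * u₁ ρ)

/-- `τ(s) = (2/F₀'(s)) ln (F₀''(s)/(F₀''(s) - F₀'(s)))` -/
def tauOf (u₀ u₁ : ℝ → ℝ) (s : ℝ) : ℝ :=
  (2 / deriv (F0 u₀ u₁) s) *
    Real.log (deriv (deriv (F0 u₀ u₁)) s / (deriv (deriv (F0 u₀ u₁)) s - deriv (F0 u₀ u₁) s))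

def setA (M : ℝ) (u₀ u₁ : ℝ → ℝ) : Set ℝ :=
  {s | s ∈ Set.Ioo (-M) M ∧ deriv (F0 u₀ u₁) s ≠ 0 ∧
    0 < deriv (deriv (F0 u₀ u₁)) s / (deriv (deriv (F0 u₀ u₁)) s - deriv (F0 u₀ u₁) s) ∧
    0 < tauOf u₀ u₁ s}

def setB (M : ℝ) (u₀ u₁ : ℝ → ℝ) : Set ℝ :=
  {s | s ∈ Set.Ioo (-M) M ∧ deriv (F0 u₀ u₁) s = 0 ∧ 0 < deriv (deriv (F0 u₀ u₁)) s}

/-- `τ₀ = min { min_{s ∈ A} τ(s), min_{s ∈ B} 2/F₀''(s) }` -/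
def tau0 (M : ℝ) (u₀ u₁ : ℝ → ℝ) : ℝ :=
  sInf (tauOf u₀ u₁ '' setA M u₀ u₁ ∪
    (fun s => 2 / deriv (deriv (F0 u₀ u₁)) s) '' setB M u₀ u₁)

/-- A continuous function vanishing for `M < |s|` vanishes for `M ≤ |s|`. -/
theorem eq_zero_of_le_abs {f : ℝ → ℝ} {M : ℝ} (hM : 0 < M) (hf : Continuous f)
    (h : ∀ s, M < |s| → f s = 0) {s : ℝ} (hs : M ≤ |s|) : f s = 0 := by
  have hlim : Tendsto (fun t : ℝ => f (t * s)) (nhdsWithin 1 (Set.Ioi 1)) (nhds (f (1 * s))) :=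
    ((hf.comp (continuous_id.mul continuous_const)).tendsto 1).mono_left nhdsWithin_le_nhds
  rw [one_mul] at hlim
  refine tendsto_nhds_unique (hlim.congr' ?_) tendsto_const_nhds
  filter_upwards [self_mem_nhdsWithin] with t ht
  have ht : 1 < t := ht
  apply h
  rw [abs_mul, abs_of_pos (by linarith)]
  nlinarith

/-- The derivative of a function vanishing for `M < |s|` vanishes there too. -/
theorem deriv_eq_zero_of_lt_abs {f : ℝ → ℝ} {M : ℝ} (h : ∀ s, M < |s| → f s = 0) {s : ℝ}
    (hs : M < |s|) : deriv f s = 0 := by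
  have hev : f =ᶠ[nhds s] fun _ => 0 := by
    filter_upwards [continuous_abs.continuousAt.eventually (lt_mem_nhds hs)] with t ht
    exact h t ht
  rw [hev.deriv_eq, deriv_const]

theorem hasDerivAt_integral_Ioi {g : ℝ → ℝ} (hg : Continuous g) (hint : Integrable g) (s : ℝ) :
    HasDerivAt (fun x => ∫ ρ in Set.Ioi x, g ρ) (-g s) s := by
  have heq : (fun x => ∫ ρ in Set.Ioi x, g ρ) =
      fun x => (∫ ρ in Set.Ioi 0, g ρ) - ∫ ρ in (0 : ℝ)..x, g ρ := by
    funext x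
    rw [← intervalIntegral.integral_interval_add_Ioi (a := 0) (b := x)
      hint.integrableOn hint.integrableOn]
    ring
  rw [heq]
  exact (hg.integral_hasStrictDerivAt 0 s).hasDerivAt.const_sub _

theorem deriv_F0 {M : ℝ} {u₀ u₁ : ℝ → ℝ}
    (hu₀ : ContDiff ℝ (⊤ : ℕ∞) u₀) (hu₁ : ContDiff ℝ (⊤ : ℕ∞) u₁)
    (hsupp₁ : ∀ s, M < |s| → u₁ s = 0) :
    deriv (F0 u₀ u₁) = fun s => (1 / 2) * (u₀ s + s * deriv u₀ s - s * u₁ s) := by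
  have hcont : Continuous fun ρ : ℝ => ρ * u₁ ρ := continuous_id.mul hu₁.continuous
  have hint : Integrable fun ρ : ℝ => ρ * u₁ ρ := by
    refine hcont.integrable_of_hasCompactSupport
      (HasCompactSupport.intro (isCompact_Icc (a := -M) (b := M)) fun x hx => ?_)
    rw [hsupp₁ x (by by_contra! h; exact hx (abs_le.mp h)), mul_zero]
  funext s
  have h₀ : HasDerivAt u₀ (deriv u₀ s) s :=
    (hu₀.differentiable (by simp)).differentiableAt.hasDerivAt
  have h := (((hasDerivAt_id s).mul h₀).add
    (hasDerivAt_integral_Ioi hcont hint s)).const_mul (1 / 2 : ℝ)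
  refine HasDerivAt.deriv (f := F0 u₀ u₁) (h.congr_deriv ?_)
  simp only [id]
  ring

theorem deriv_F0_eq_zero_and_deriv_deriv_F0_eq_zero {M : ℝ} (hM : 0 < M) {u₀ u₁ : ℝ → ℝ}
    (hu₀ : ContDiff ℝ (⊤ : ℕ∞) u₀) (hu₁ : ContDiff ℝ (⊤ : ℕ∞) u₁)
    (hsupp₀ : ∀ s, M < |s| → u₀ s = 0) (hsupp₁ : ∀ s, M < |s| → u₁ s = 0)
    {s : ℝ} (hs : M ≤ |s|) :
    deriv (F0 u₀ u₁) s = 0 ∧ deriv (deriv (F0 u₀ u₁)) s = 0 := by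
  have hzero : ∀ t, M < |t| → deriv (F0 u₀ u₁) t = 0 := fun t ht => by
    rw [deriv_F0 hu₀ hu₁ hsupp₁]
    simp [hsupp₀ t ht, hsupp₁ t ht, deriv_eq_zero_of_lt_abs hsupp₀ ht]
  have hsmooth : ContDiff ℝ (⊤ : ℕ∞) (deriv (F0 u₀ u₁)) := by
    have hd : ContDiff ℝ (⊤ : ℕ∞) (deriv u₀) := (contDiff_infty_iff_deriv.mp hu₀).2
    rw [deriv_F0 hu₀ hu₁ hsupp₁]
    fun_prop
  exact ⟨eq_zero_of_le_abs hM hsmooth.continuous hzero hs,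
    eq_zero_of_le_abs hM (hsmooth.continuous_deriv (by simp))
      (fun t ht => deriv_eq_zero_of_lt_abs hzero ht) hs⟩

/-- If `τ ↦ exp (a τ / 2) (1 - b / a) + b / a` is nonpositive at some `τ ≥ 0`, then its zero
`(2 / a) log (b / (b - a))` is well defined, positive and at most `τ`. -/
theorem log_le_of_exp_mul_add_nonpos {a b τ : ℝ} (ha : a ≠ 0) (hτ : 0 ≤ τ)
    (h : Real.exp ((1 / 2) * a * τ) * (1 - b / a) + b / a ≤ 0) :
    0 < b / (b - a) ∧ 0 < 2 / a * Real.log (b / (b - a)) ∧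
      2 / a * Real.log (b / (b - a)) ≤ τ := by
  set e := Real.exp ((1 / 2) * a * τ) with he
  have hepos : 0 < e := Real.exp_pos _
  have hloge : Real.log e = (1 / 2) * a * τ := Real.log_exp _
  have hform : e * (1 - b / a) + b / a = (e * (a - b) + b) / a := by field_simp
  rw [hform] at h
  rcases lt_or_gt_of_ne ha with ha | ha
  · have hnum : 0 ≤ e * (a - b) + b := by
      by_contra! hlt
      exact absurd h (not_le.mpr (div_pos_of_neg_of_neg hlt ha))
    have he1 : e ≤ 1 := Real.exp_le_one_iff.mpr (by nlinarith)
    have hb : 0 < b := by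
      by_contra! hb
      nlinarith [mul_pos_of_neg_of_neg ha (neg_neg_of_pos hepos)]
    have hba : 0 < b - a := by linarith
    have hpos : 0 < b / (b - a) := div_pos hb hba
    have hlog : Real.log (b / (b - a)) < 0 :=
      Real.log_neg hpos ((div_lt_one hba).mpr (by linarith))
    have hle : (1 / 2) * a * τ ≤ Real.log (b / (b - a)) := by
      rw [← hloge]
      exact Real.log_le_log hepos ((le_div_iff₀ hba).mpr (by linarith))
    refine ⟨hpos, mul_pos_of_neg_of_neg (div_neg_of_pos_of_neg two_pos ha) hlog, ?_⟩
    rw [div_mul_eq_mul_div, div_le_iff_of_neg ha]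
    linarith
  · have hnum : e * (a - b) + b ≤ 0 := by
      by_contra! hlt
      exact absurd h (not_le.mpr (div_pos hlt ha))
    have he1 : 1 ≤ e := Real.one_le_exp (by positivity)
    have hb : 0 < b := by
      by_contra! hb
      nlinarith [mul_pos ha hepos]
    have hba : 0 < b - a := by
      by_contra! hba
      nlinarith
    have hpos : 0 < b / (b - a) := div_pos hb hba
    have hlog : 0 < Real.log (b / (b - a)) :=
      Real.log_pos ((one_lt_div hba).mpr (by linarith))
    have hle : Real.log (b / (b - a)) ≤ (1 / 2) * a * τ := by
      rw [← hloge]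
      exact Real.log_le_log hpos ((div_le_iff₀ hba).mpr (by linarith))
    refine ⟨hpos, mul_pos (div_pos two_pos ha) hlog, ?_⟩
    rw [div_mul_eq_mul_div, div_le_iff₀ ha]
    linarith

theorem tau0_le {M : ℝ} {u₀ u₁ : ℝ → ℝ} {t : ℝ}
    (ht : t ∈ tauOf u₀ u₁ '' setA M u₀ u₁ ∪
      (fun s => 2 / deriv (deriv (F0 u₀ u₁)) s) '' setB M u₀ u₁) :
    tau0 M u₀ u₁ ≤ t := by
  refine csInf_le ⟨0, ?_⟩ ht
  rintro _ (⟨s, hs, rfl⟩ | ⟨s, hs, rfl⟩)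
  · exact hs.2.2.2.le
  · exact (div_pos two_pos hs.2.2).le

theorem jacobian_positive (M : ℝ) (hM : 0 < M) (u₀ u₁ : ℝ → ℝ)
    (hu₀ : ContDiff ℝ (⊤ : ℕ∞) u₀) (hu₁ : ContDiff ℝ (⊤ : ℕ∞) u₁)
    (heven₀ : ∀ s, u₀ (-s) = u₀ s) (heven₁ : ∀ s, u₁ (-s) = u₁ s)
    (hsupp₀ : ∀ s, M < |s| → u₀ s = 0) (hsupp₁ : ∀ s, M < |s| → u₁ s = 0)
    (hne : u₀ ≠ 0 ∨ u₁ ≠ 0) :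
    ∀ s ∈ Set.Icc (-M) M, ∀ τ : ℝ, 0 ≤ τ → τ < tau0 M u₀ u₁ →
      (deriv (F0 u₀ u₁) s ≠ 0 →
        0 < Real.exp ((1 / 2) * deriv (F0 u₀ u₁) s * τ) *
              (1 - deriv (deriv (F0 u₀ u₁)) s / deriv (F0 u₀ u₁) s)
            + deriv (deriv (F0 u₀ u₁)) s / deriv (F0 u₀ u₁) s) ∧
      (deriv (F0 u₀ u₁) s = 0 →
        0 < 1 - (τ / 2) * deriv (deriv (F0 u₀ u₁)) s) := by
  intro s hs τ hτ hlt
  rcases le_or_gt M |s| with hMs | hMs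
  · obtain ⟨h₁, h₂⟩ := deriv_F0_eq_zero_and_deriv_deriv_F0_eq_zero hM hu₀ hu₁ hsupp₀ hsupp₁ hMs
    exact ⟨fun h => absurd h₁ h, fun _ => by simp [h₂]⟩
  · have hmem : s ∈ Set.Ioo (-M) M := abs_lt.mp hMs
    refine ⟨fun ha => ?_, fun ha => ?_⟩
    · by_contra! h
      obtain ⟨hdiv, hpos, hle⟩ := log_le_of_exp_mul_add_nonpos ha hτ h
      have := tau0_le (Or.inl (mem_image_of_mem (tauOf u₀ u₁)
        (show s ∈ setA M u₀ u₁ from ⟨hmem, ha, hdiv, hpos⟩)))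
      exact absurd (this.trans hle) (not_le.mpr hlt)
    · rcases le_or_gt (deriv (deriv (F0 u₀ u₁)) s) 0 with hb | hb
      · nlinarith
      · have := hlt.trans_le (tau0_le (Or.inr ⟨s, ⟨hmem, ha, hb⟩, rfl⟩))
        rw [lt_div_iff₀ hb] at this
        linarith
end
end

section
/- Let u = u(t, r) be a C³ function on an open subset of (0,∞) × (0,∞) with 1 + u + ∂_t u > 0, set c = √(1 + u + ∂_t u), U = r u, L₁ = ∂_t + c∂_r, L₂ = ∂_t − c∂_r, w₁ = L₂∂_r U, w₂ = L₁∂_r U, and suppose ∂_t²U − c²∂_r²U = 0. Then w₂ satisfies L₂w₂ = (1/(4rc))w₂² + (w₂/(4rc))(−w₁ − ∂_t u + (r/c)L₁u) + (w₁/(4rc))(∂_t u − (r/c)L₁u). -/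
open Set

noncomputable section

/-- `∂_t` for functions of `(t, r)` -/
def Pt (f : ℝ → ℝ → ℝ) (t r : ℝ) : ℝ := deriv (fun s => f s r) t

/-- `∂_r` for functions of `(t, r)` -/
def Pr (f : ℝ → ℝ → ℝ) (t r : ℝ) : ℝ := deriv (fun ρ => f t ρ) r

/-- `c = √(1 + u + ∂_t u)` -/
def cfun (u : ℝ → ℝ → ℝ) (t r : ℝ) : ℝ := Real.sqrt (1 + u t r + Pt u t r)

/-- `U = r u` -/
def Ufun (u : ℝ → ℝ → ℝ) (t r : ℝ) : ℝ := r * u t r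

/-- `L₁ = ∂_t + c ∂_r` -/
def L1op (u f : ℝ → ℝ → ℝ) (t r : ℝ) : ℝ := Pt f t r + cfun u t r * Pr f t r

/-- `L₂ = ∂_t - c ∂_r` -/
def L2op (u f : ℝ → ℝ → ℝ) (t r : ℝ) : ℝ := Pt f t r - cfun u t r * Pr f t r

/-- `w₁ = L₂ ∂_r U` -/
def w1 (u : ℝ → ℝ → ℝ) : ℝ → ℝ → ℝ := L2op u (Pr (Ufun u))

/-- `w₂ = L₁ ∂_r U` -/
def w2 (u : ℝ → ℝ → ℝ) : ℝ → ℝ → ℝ := L1op u (Pr (Ufun u))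

section PartialDerivatives

variable {f g : ℝ → ℝ → ℝ} {t r : ℝ} {Ω : Set (ℝ × ℝ)}

lemma DifferentiableAt.hasDerivAt_Pt (h : DifferentiableAt ℝ (fun p : ℝ × ℝ => f p.1 p.2) (t, r)) :
    HasDerivAt (fun s => f s r) (Pt f t r) t := by
  have h1 : HasDerivAt (fun s : ℝ => (s, r)) ((1 : ℝ), (0 : ℝ)) t :=
    (hasDerivAt_id t).prodMk (hasDerivAt_const t r)
  exact (h.hasFDerivAt.comp_hasDerivAt t h1).differentiableAt.hasDerivAt

lemma DifferentiableAt.hasDerivAt_Pr (h : DifferentiableAt ℝ (fun p : ℝ × ℝ => f p.1 p.2) (t, r)) :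
    HasDerivAt (fun ρ => f t ρ) (Pr f t r) r := by
  have h1 : HasDerivAt (fun ρ : ℝ => (t, ρ)) ((0 : ℝ), (1 : ℝ)) r :=
    (hasDerivAt_const r t).prodMk (hasDerivAt_id r)
  exact (h.hasFDerivAt.comp_hasDerivAt r h1).differentiableAt.hasDerivAt

lemma Pt_eq_fderiv (h : DifferentiableAt ℝ (fun p : ℝ × ℝ => f p.1 p.2) (t, r)) :
    Pt f t r = fderiv ℝ (fun p : ℝ × ℝ => f p.1 p.2) (t, r) (1, 0) := by
  have h1 : HasDerivAt (fun s : ℝ => (s, r)) ((1 : ℝ), (0 : ℝ)) t :=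
    (hasDerivAt_id t).prodMk (hasDerivAt_const t r)
  exact (h.hasFDerivAt.comp_hasDerivAt t h1).deriv

lemma Pr_eq_fderiv (h : DifferentiableAt ℝ (fun p : ℝ × ℝ => f p.1 p.2) (t, r)) :
    Pr f t r = fderiv ℝ (fun p : ℝ × ℝ => f p.1 p.2) (t, r) (0, 1) := by
  have h1 : HasDerivAt (fun ρ : ℝ => (t, ρ)) ((0 : ℝ), (1 : ℝ)) r :=
    (hasDerivAt_const r t).prodMk (hasDerivAt_id r)
  exact (h.hasFDerivAt.comp_hasDerivAt r h1).deriv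

lemma Pt_congr_of_isOpen (hΩ : IsOpen Ω) (h : ∀ t r, (t, r) ∈ Ω → f t r = g t r)
    (hm : (t, r) ∈ Ω) : Pt f t r = Pt g t r := by
  have hc : ContinuousAt (fun s : ℝ => (s, r)) t := by fun_prop
  refine Filter.EventuallyEq.deriv_eq ?_
  filter_upwards [hc.preimage_mem_nhds (hΩ.mem_nhds hm)] with s hs using h s r hs

lemma Pr_congr_of_isOpen (hΩ : IsOpen Ω) (h : ∀ t r, (t, r) ∈ Ω → f t r = g t r)
    (hm : (t, r) ∈ Ω) : Pr f t r = Pr g t r := by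
  have hc : ContinuousAt (fun ρ : ℝ => (t, ρ)) r := by fun_prop
  refine Filter.EventuallyEq.deriv_eq ?_
  filter_upwards [hc.preimage_mem_nhds (hΩ.mem_nhds hm)] with ρ hρ using h t ρ hρ

lemma ContDiffOn.differentiableAt_of_isOpen {F : ℝ × ℝ → ℝ} {n : WithTop ℕ∞}
    (hF : ContDiffOn ℝ n F Ω) (hΩ : IsOpen Ω) (hn : n ≠ 0) {p : ℝ × ℝ} (hp : p ∈ Ω) :
    DifferentiableAt ℝ F p :=
  (hF.contDiffAt (hΩ.mem_nhds hp)).differentiableAt hn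

lemma ContDiffOn.Pt {m n : WithTop ℕ∞} (hf : ContDiffOn ℝ n (fun p : ℝ × ℝ => f p.1 p.2) Ω)
    (hΩ : IsOpen Ω) (hmn : m + 1 ≤ n) :
    ContDiffOn ℝ m (fun p : ℝ × ℝ => Pt f p.1 p.2) Ω := by
  have hn : n ≠ 0 := by
    rintro rfl
    simp at hmn
  refine ((hf.fderiv_of_isOpen hΩ hmn).clm_apply (contDiffOn_const (c := ((1 : ℝ), (0 : ℝ))))).congr
    fun p hp => ?_
  exact Pt_eq_fderiv (hf.differentiableAt_of_isOpen hΩ hn hp)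

lemma ContDiffOn.Pr {m n : WithTop ℕ∞} (hf : ContDiffOn ℝ n (fun p : ℝ × ℝ => f p.1 p.2) Ω)
    (hΩ : IsOpen Ω) (hmn : m + 1 ≤ n) :
    ContDiffOn ℝ m (fun p : ℝ × ℝ => Pr f p.1 p.2) Ω := by
  have hn : n ≠ 0 := by
    rintro rfl
    simp at hmn
  refine ((hf.fderiv_of_isOpen hΩ hmn).clm_apply (contDiffOn_const (c := ((0 : ℝ), (1 : ℝ))))).congr
    fun p hp => ?_
  exact Pr_eq_fderiv (hf.differentiableAt_of_isOpen hΩ hn hp)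

lemma Pt_Pr_comm (hΩ : IsOpen Ω) (hf : ContDiffOn ℝ 2 (fun p : ℝ × ℝ => f p.1 p.2) Ω)
    (hm : (t, r) ∈ Ω) : Pt (Pr f) t r = Pr (Pt f) t r := by
  have hone : (1 : WithTop ℕ∞) + 1 ≤ 2 := by norm_num
  have hd : DifferentiableAt ℝ (fderiv ℝ (fun p : ℝ × ℝ => f p.1 p.2)) (t, r) :=
    ((hf.fderiv_of_isOpen hΩ hone).contDiffAt (hΩ.mem_nhds hm)).differentiableAt one_ne_zero
  have hsymm := (hf.contDiffAt (hΩ.mem_nhds hm)).isSymmSndFDerivAt (by simp)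
  rw [Pt_eq_fderiv ((hf.Pr hΩ hone).differentiableAt_of_isOpen hΩ one_ne_zero hm),
    Pr_eq_fderiv ((hf.Pt hΩ hone).differentiableAt_of_isOpen hΩ one_ne_zero hm)]
  have e1 : (fun p : ℝ × ℝ => Pr f p.1 p.2) =ᶠ[nhds (t, r)]
      fun p => fderiv ℝ (fun p : ℝ × ℝ => f p.1 p.2) p (0, 1) := by
    filter_upwards [hΩ.mem_nhds hm] with p hp
      using Pr_eq_fderiv (hf.differentiableAt_of_isOpen hΩ two_ne_zero hp)
  have e2 : (fun p : ℝ × ℝ => Pt f p.1 p.2) =ᶠ[nhds (t, r)]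
      fun p => fderiv ℝ (fun p : ℝ × ℝ => f p.1 p.2) p (1, 0) := by
    filter_upwards [hΩ.mem_nhds hm] with p hp
      using Pt_eq_fderiv (hf.differentiableAt_of_isOpen hΩ two_ne_zero hp)
  rw [e1.fderiv_eq, e2.fderiv_eq, fderiv_clm_apply hd (differentiableAt_const _),
    fderiv_clm_apply hd (differentiableAt_const _)]
  simpa using hsymm (1, 0) (0, 1)

end PartialDerivatives

theorem riccati_equation_w2 (Ω : Set (ℝ × ℝ)) (hΩ : IsOpen Ω)
    (hΩsub : Ω ⊆ Set.Ioi 0 ×ˢ Set.Ioi 0) (u : ℝ → ℝ → ℝ)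
    (hreg : ContDiffOn ℝ 3 (fun p : ℝ × ℝ => u p.1 p.2) Ω)
    (hpos : ∀ t r : ℝ, (t, r) ∈ Ω → 0 < 1 + u t r + Pt u t r)
    (hwave : ∀ t r : ℝ, (t, r) ∈ Ω →
      Pt (Pt (Ufun u)) t r = (cfun u t r) ^ 2 * Pr (Pr (Ufun u)) t r) :
    ∀ t r : ℝ, (t, r) ∈ Ω →
      L2op u (w2 u) t r =
        (1 / (4 * r * cfun u t r)) * (w2 u t r) ^ 2
        + (w2 u t r / (4 * r * cfun u t r)) *
            (-w1 u t r - Pt u t r + (r / cfun u t r) * L1op u u t r)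
        + (w1 u t r / (4 * r * cfun u t r)) *
            (Pt u t r - (r / cfun u t r) * L1op u u t r) := by
  have h23 : (2 : WithTop ℕ∞) + 1 ≤ 3 := by norm_num
  have h12 : (1 : WithTop ℕ∞) + 1 ≤ 2 := by norm_num
  have hU : ContDiffOn ℝ 3 (fun p : ℝ × ℝ => Ufun u p.1 p.2) Ω := contDiffOn_snd.mul hreg
  have hut := hreg.Pt hΩ h23
  have hc : ContDiffOn ℝ 2 (fun p : ℝ × ℝ => cfun u p.1 p.2) Ω :=
    ((contDiffOn_const.add (hreg.of_le (by norm_num))).add hut).sqrt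
      fun p hp => (hpos p.1 p.2 hp).ne'
  have hV := hU.Pr hΩ h23
  have hVt := hV.Pt hΩ h12
  have hVr := hV.Pr hΩ h12
  intro t r hm
  have hr : r ≠ 0 := (hΩsub hm).2.ne'
  have hcpos : 0 < cfun u t r := Real.sqrt_pos.2 (hpos t r hm)
  have du := hreg.differentiableAt_of_isOpen hΩ three_ne_zero hm
  have dut := hut.differentiableAt_of_isOpen hΩ two_ne_zero hm
  have dc := hc.differentiableAt_of_isOpen hΩ two_ne_zero hm
  have dVt := hVt.differentiableAt_of_isOpen hΩ one_ne_zero hm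
  have dVr := hVr.differentiableAt_of_isOpen hΩ one_ne_zero hm
  have hsq : ∀ t r, (t, r) ∈ Ω → cfun u t r * cfun u t r = 1 + u t r + Pt u t r :=
    fun t r h => Real.mul_self_sqrt (hpos t r h).le
  -- derivatives of `c² = 1 + u + ∂_t u`
  have hct : Pt (cfun u) t r * cfun u t r + cfun u t r * Pt (cfun u) t r
      = Pt u t r + Pt (Pt u) t r :=
    (dc.hasDerivAt_Pt.mul dc.hasDerivAt_Pt).deriv.symm.trans <|
      (Pt_congr_of_isOpen hΩ hsq hm).trans
        ((du.hasDerivAt_Pt.const_add 1).add dut.hasDerivAt_Pt).deriv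
  have hcr : Pr (cfun u) t r * cfun u t r + cfun u t r * Pr (cfun u) t r
      = Pr u t r + Pr (Pt u) t r :=
    (dc.hasDerivAt_Pr.mul dc.hasDerivAt_Pr).deriv.symm.trans <|
      (Pr_congr_of_isOpen hΩ hsq hm).trans
        ((du.hasDerivAt_Pr.const_add 1).add dut.hasDerivAt_Pr).deriv
  have hUt : Pt (Ufun u) = Ufun (Pt u) := by
    funext t r
    exact deriv_const_mul_field r
  have hUtt : Pt (Pt (Ufun u)) t r = r * Pt (Pt u) t r := by
    rw [hUt]
    exact deriv_const_mul_field r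
  have hw := hwave t r hm
  rw [hUtt] at hw
  have hmixed : Pt (Pr (Ufun u)) t r = Pt u t r + r * Pr (Pt u) t r := by
    rw [Pt_Pr_comm hΩ (hU.of_le (by norm_num)) hm, hUt]
    exact ((hasDerivAt_id r).mul dut.hasDerivAt_Pr).deriv.trans (by simp)
  -- `∂_r` of the wave equation
  have hthird : Pt (Pt (Pr (Ufun u))) t r = Pr (Pt (Pt (Ufun u))) t r := by
    rw [← Pt_Pr_comm hΩ (hU.Pt hΩ h23) hm]
    exact Pt_congr_of_isOpen hΩ
      (fun t r h => Pt_Pr_comm hΩ (hU.of_le (by norm_num)) h) hm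
  have hwr : Pr (Pt (Pt (Ufun u))) t r
      = 2 * cfun u t r * Pr (cfun u) t r * Pr (Pr (Ufun u)) t r
        + cfun u t r ^ 2 * Pr (Pr (Pr (Ufun u))) t r := by
    refine (Pr_congr_of_isOpen hΩ hwave hm).trans
      (((dc.hasDerivAt_Pr.pow 2).mul dVr.hasDerivAt_Pr).deriv.trans ?_)
    simp
  have hw2t : Pt (w2 u) t r = Pt (Pt (Pr (Ufun u))) t r
      + (Pt (cfun u) t r * Pr (Pr (Ufun u)) t r + cfun u t r * Pt (Pr (Pr (Ufun u))) t r) :=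
    (dVt.hasDerivAt_Pt.add (dc.hasDerivAt_Pt.mul dVr.hasDerivAt_Pt)).deriv
  have hw2r : Pr (w2 u) t r = Pr (Pt (Pr (Ufun u))) t r
      + (Pr (cfun u) t r * Pr (Pr (Ufun u)) t r + cfun u t r * Pr (Pr (Pr (Ufun u))) t r) :=
    (dVt.hasDerivAt_Pr.add (dc.hasDerivAt_Pr.mul dVr.hasDerivAt_Pr)).deriv
  have hVcomm := Pt_Pr_comm hΩ hV hm
  have hL2 : L2op u (w2 u) t r
      = (Pt (cfun u) t r + cfun u t r * Pr (cfun u) t r) * Pr (Pr (Ufun u)) t r := by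
    rw [L2op, hw2t, hw2r, hthird, hwr, hVcomm]
    ring
  rw [hL2]
  simp only [w2, w1, L1op, L2op, hmixed]
  have hutt : Pt (Pt u) t r = cfun u t r ^ 2 * Pr (Pr (Ufun u)) t r / r := by
    rw [eq_div_iff hr, ← hw, mul_comm]
  have hct' : Pt (cfun u) t r = (Pt u t r + Pt (Pt u) t r) / (2 * cfun u t r) := by
    rw [eq_div_iff (by positivity)]
    linarith
  have hcr' : Pr (cfun u) t r = (Pr u t r + Pr (Pt u) t r) / (2 * cfun u t r) := by
    rw [eq_div_iff (by positivity)]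
    linarith
  have hc0 := hcpos.ne'
  rw [hct', hcr', hutt]
  field_simp
  ring
end
end
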